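/- Let n ≥ 1, σ > 0, and let g : ℝⁿ → ℂ be measurable. Then g satisfies the strong A-condition with exponent 2σ if and only if there exist constants c₁, c₂ > 0 such that for all t > 0: c₁ t^{−2σ} ≤ ∫_{ℝⁿ} e^{−2t|ξ|²} |g(ξ)|² dξ ≤ c₂ t^{−2σ} (the integral being a priori valued in [0,+∞]). By Plancherel this integral equals ‖e^{tΔ}f‖_{L²}² for the tempered distribution f with Fourier transform g, so this characterizes the set Ȧ^{−2σ}_{2,∞} by the two-sided heat decay c₁′ t^{−σ} ≤ ‖e^{tΔ}f‖₂ ≤ c₂′ t^{−σ} for all t > 0. -/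

import Mathlib

open MeasureTheory Filter Topology
open scoped ENNReal NNReal

noncomputable section

/-- The quantity `ρ^{-(2r+n)} ∫_{|ξ|≤ρ} |g(ξ)|² dξ`, valued in `[0,∞]`. -/
def decayFun (n : ℕ) (g : EuclideanSpace ℝ (Fin n) → ℂ) (r ρ : ℝ) : ℝ≥0∞ :=
  ENNReal.ofReal (ρ ^ (-(2 * r + (n : ℝ)))) *
    ∫⁻ ξ in {ξ : EuclideanSpace ℝ (Fin n) | ‖ξ‖ ≤ ρ}, ENNReal.ofReal (‖g ξ‖ ^ 2)

/-- Lower decay indicator `P_r(g)₋`. -/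
def Pminus (n : ℕ) (g : EuclideanSpace ℝ (Fin n) → ℂ) (r : ℝ) : ℝ≥0∞ :=
  liminf (fun ρ : ℝ => decayFun n g r ρ) (𝓝[>] (0 : ℝ))

/-- Upper decay indicator `P_r(g)₊`. -/
def Pplus (n : ℕ) (g : EuclideanSpace ℝ (Fin n) → ℂ) (r : ℝ) : ℝ≥0∞ :=
  limsup (fun ρ : ℝ => decayFun n g r ρ) (𝓝[>] (0 : ℝ))

/-- `E_α(t) = ∫_{ℝⁿ} e^{−2t|ξ|^{2α}} |g(ξ)|² dξ`, valued in `[0,∞]`. -/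
def Ealpha (n : ℕ) (g : EuclideanSpace ℝ (Fin n) → ℂ) (α t : ℝ) : ℝ≥0∞ :=
  ∫⁻ ξ : EuclideanSpace ℝ (Fin n),
    ENNReal.ofReal (Real.exp (-(2 * t) * ‖ξ‖ ^ (2 * α)) * ‖g ξ‖ ^ 2)

/-- Sharp Littlewood–Paley block: `a_j(g) = (∫_{2^j ≤ |ξ| < 2^{j+1}} |g(ξ)|² dξ)^{1/2}`. -/
def ajBlock (n : ℕ) (g : EuclideanSpace ℝ (Fin n) → ℂ) (j : ℤ) : ℝ≥0∞ :=
  (∫⁻ ξ in {ξ : EuclideanSpace ℝ (Fin n) |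
      (2 : ℝ) ^ (j : ℝ) ≤ ‖ξ‖ ∧ ‖ξ‖ < (2 : ℝ) ^ ((j : ℝ) + 1)},
    ENNReal.ofReal (‖g ξ‖ ^ 2)) ^ (1 / 2 : ℝ)

/-- The strong A-condition with exponent `σ`: the Fourier-side description of `Ȧ^{-σ}_{2,∞}`. -/
def StrongACond (n : ℕ) (g : EuclideanSpace ℝ (Fin n) → ℂ) (σ : ℝ) : Prop :=
  ∃ c C : ℝ, 0 < c ∧ 0 < C ∧ ∃ M : ℕ, 0 < M ∧
    (∀ j : ℤ, ajBlock n g j ≤ ENNReal.ofReal (C * (2 : ℝ) ^ (σ * (j : ℝ)))) ∧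
    (∀ j₀ : ℤ, ∃ j : ℤ, j₀ ≤ j ∧ j < j₀ + M ∧
      ENNReal.ofReal (c * (2 : ℝ) ^ (σ * (j : ℝ))) ≤ ajBlock n g j)

/-- The weak A-condition with exponent `σ`: the Fourier-side description of `𝒜^{-σ}_{2,∞}`. -/
def WeakACond (n : ℕ) (g : EuclideanSpace ℝ (Fin n) → ℂ) (σ : ℝ) : Prop :=
  ∃ c C : ℝ, 0 < c ∧ 0 < C ∧ ∃ jk : ℕ → ℤ,
    Filter.Tendsto jk Filter.atTop Filter.atBot ∧
    (∃ M : ℕ, ∀ k : ℕ, |jk k - jk (k + 1)| ≤ M) ∧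
    (∀ j : ℤ, ajBlock n g j ≤ ENNReal.ofReal (C * (2 : ℝ) ^ (σ * (j : ℝ)))) ∧
    (∀ k : ℕ, ENNReal.ofReal (c * (2 : ℝ) ^ (σ * (jk k : ℝ))) ≤ ajBlock n g (jk k))

/-- The squared block `a_j(g)² = ∫_{2^j ≤ |ξ| < 2^{j+1}} |g(ξ)|² dξ`. -/
def blockEnergy (n : ℕ) (g : EuclideanSpace ℝ (Fin n) → ℂ) (j : ℤ) : ℝ≥0∞ :=
  ∫⁻ ξ in {ξ : EuclideanSpace ℝ (Fin n) |
      (2 : ℝ) ^ (j : ℝ) ≤ ‖ξ‖ ∧ ‖ξ‖ < (2 : ℝ) ^ ((j : ℝ) + 1)},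
    ENNReal.ofReal (‖g ξ‖ ^ 2)

lemma two_rpow_sq_block (c σ : ℝ) (j : ℤ) :
    (c * (2 : ℝ) ^ (2 * σ * (j : ℝ))) ^ 2 = c ^ 2 * (2 : ℝ) ^ (4 * σ * (j : ℝ)) := by
  rw [mul_pow, ← Real.rpow_natCast ((2 : ℝ) ^ _), ← Real.rpow_mul (by norm_num)]
  congr 2
  push_cast
  ring

lemma ajBlock_le_iff {n : ℕ} {g : EuclideanSpace ℝ (Fin n) → ℂ} {j : ℤ} {y : ℝ} (hy : 0 ≤ y) :
    ajBlock n g j ≤ ENNReal.ofReal y ↔ blockEnergy n g j ≤ ENNReal.ofReal (y ^ 2) := by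
  have h : ajBlock n g j = blockEnergy n g j ^ (2 : ℝ)⁻¹ := by
    rw [ajBlock, blockEnergy, one_div]
  rw [h, ENNReal.rpow_inv_le_iff (by norm_num), ENNReal.ofReal_rpow_of_nonneg hy (by norm_num)]
  norm_num

lemma le_ajBlock_iff {n : ℕ} {g : EuclideanSpace ℝ (Fin n) → ℂ} {j : ℤ} {y : ℝ} (hy : 0 ≤ y) :
    ENNReal.ofReal y ≤ ajBlock n g j ↔ ENNReal.ofReal (y ^ 2) ≤ blockEnergy n g j := by
  have h : ajBlock n g j = blockEnergy n g j ^ (2 : ℝ)⁻¹ := by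
    rw [ajBlock, blockEnergy, one_div]
  rw [h, ENNReal.le_rpow_inv_iff (by norm_num), ENNReal.ofReal_rpow_of_nonneg hy (by norm_num)]
  norm_num

lemma strongACond_iff_blockEnergy {n : ℕ} {g : EuclideanSpace ℝ (Fin n) → ℂ} {σ : ℝ} :
    StrongACond n g (2 * σ) ↔
      ∃ c C : ℝ, 0 < c ∧ 0 < C ∧ ∃ M : ℕ, 0 < M ∧
        (∀ j : ℤ, blockEnergy n g j ≤ ENNReal.ofReal (C * (2 : ℝ) ^ (4 * σ * (j : ℝ)))) ∧
        (∀ j₀ : ℤ, ∃ j : ℤ, j₀ ≤ j ∧ j < j₀ + M ∧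
          ENNReal.ofReal (c * (2 : ℝ) ^ (4 * σ * (j : ℝ))) ≤ blockEnergy n g j) := by
  constructor
  · rintro ⟨c, C, hc, hC, M, hM, hu, hl⟩
    refine ⟨c ^ 2, C ^ 2, by positivity, by positivity, M, hM, fun j => ?_, fun j₀ => ?_⟩
    · rw [← two_rpow_sq_block, ← ajBlock_le_iff (by positivity)]
      exact hu j
    · obtain ⟨j, h1, h2, h3⟩ := hl j₀
      refine ⟨j, h1, h2, ?_⟩
      rw [← two_rpow_sq_block, ← le_ajBlock_iff (by positivity)]
      exact h3
  · rintro ⟨c, C, hc, hC, M, hM, hu, hl⟩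
    refine ⟨√c, √C, by positivity, by positivity, M, hM, fun j => ?_, fun j₀ => ?_⟩
    · rw [ajBlock_le_iff (by positivity), two_rpow_sq_block, Real.sq_sqrt hC.le]
      exact hu j
    · obtain ⟨j, h1, h2, h3⟩ := hl j₀
      refine ⟨j, h1, h2, ?_⟩
      rw [le_ajBlock_iff (by positivity), two_rpow_sq_block, Real.sq_sqrt hc.le]
      exact h3

lemma measurableSet_dyadicAnnulus (n : ℕ) (j : ℤ) :
    MeasurableSet {ξ : EuclideanSpace ℝ (Fin n) |
      (2 : ℝ) ^ (j : ℝ) ≤ ‖ξ‖ ∧ ‖ξ‖ < (2 : ℝ) ^ ((j : ℝ) + 1)} :=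
  (measurableSet_le measurable_const measurable_norm).inter
    (measurableSet_lt measurable_norm measurable_const)

/-- The heat weight is at least `e^{-8 t 4^j}` on the annulus `2^j ≤ |ξ| < 2^{j+1}`. -/
lemma exp_mul_blockEnergy_le_Ealpha {n : ℕ} {g : EuclideanSpace ℝ (Fin n) → ℂ} {t : ℝ}
    (ht : 0 < t) (j : ℤ) :
    ENNReal.ofReal (Real.exp (-(8 * (t * (4 : ℝ) ^ j)))) * blockEnergy n g j
      ≤ Ealpha n g 1 t := by
  rw [blockEnergy, Ealpha, ← lintegral_const_mul' _ _ ENNReal.ofReal_ne_top]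
  refine (setLIntegral_mono' (measurableSet_dyadicAnnulus n j) ?_).trans
    (setLIntegral_le_lintegral _ _)
  rintro ξ ⟨-, h2⟩
  rw [← ENNReal.ofReal_mul (by positivity)]
  refine ENNReal.ofReal_le_ofReal ?_
  gcongr
  have h3 : ‖ξ‖ ^ (2 * (1 : ℝ)) ≤ 4 * (4 : ℝ) ^ j := by
    have e1 : ‖ξ‖ ^ (2 * (1 : ℝ)) = ‖ξ‖ ^ 2 := by norm_num
    have e2 : (4 : ℝ) * (4 : ℝ) ^ j = ((2 : ℝ) ^ ((j : ℝ) + 1)) ^ 2 := by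
      rw [Real.rpow_add_one (by norm_num), Real.rpow_intCast, mul_pow,
        show (4 : ℝ) = 2 * 2 by norm_num, mul_zpow]
      ring
    rw [e1, e2]
    gcongr
  nlinarith [mul_le_mul_of_nonneg_left h3 ht.le]

lemma ae_mem_iUnion_dyadicAnnulus {n : ℕ} (hn : 1 ≤ n) :
    (⋃ j : ℤ, {ξ : EuclideanSpace ℝ (Fin n) |
      (2 : ℝ) ^ (j : ℝ) ≤ ‖ξ‖ ∧ ‖ξ‖ < (2 : ℝ) ^ ((j : ℝ) + 1)}) =ᵐ[volume] Set.univ := by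
  have : Nonempty (Fin n) := ⟨⟨0, hn⟩⟩
  rw [eventuallyEq_univ]
  filter_upwards [compl_mem_ae_iff.2 (measure_singleton (0 : EuclideanSpace ℝ (Fin n)))] with ξ hξ
  have hpos : 0 < ‖ξ‖ := norm_pos_iff.2 hξ
  obtain ⟨j, h1, h2⟩ := exists_mem_Ico_zpow hpos (one_lt_two : (1 : ℝ) < 2)
  refine Set.mem_iUnion.2 ⟨j, ?_, ?_⟩
  · rwa [Real.rpow_intCast]
  · rw [show (j : ℝ) + 1 = ((j + 1 : ℤ) : ℝ) by push_cast; rfl, Real.rpow_intCast]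
    exact h2

lemma Ealpha_le_tsum {n : ℕ} (hn : 1 ≤ n) {g : EuclideanSpace ℝ (Fin n) → ℂ} {t : ℝ}
    (k : ℤ) (hk : ((4 : ℝ) ^ (k + 1))⁻¹ ≤ t) :
    Ealpha n g 1 t ≤
      ∑' m : ℤ, ENNReal.ofReal (Real.exp (-((4 : ℝ) ^ m / 2))) * blockEnergy n g (k + m) := by
  have ht : 0 < t := lt_of_lt_of_le (by positivity) hk
  rw [← (Equiv.subRight k).tsum_eq, Ealpha, ← setLIntegral_univ,
    ← setLIntegral_congr (ae_mem_iUnion_dyadicAnnulus hn)]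
  refine (lintegral_iUnion_le _ _).trans (ENNReal.tsum_le_tsum fun j => ?_)
  rw [Equiv.subRight_apply, add_sub_cancel, blockEnergy,
    ← lintegral_const_mul' _ _ ENNReal.ofReal_ne_top]
  refine setLIntegral_mono' (measurableSet_dyadicAnnulus n j) ?_
  rintro ξ ⟨h1, -⟩
  rw [← ENNReal.ofReal_mul (by positivity)]
  refine ENNReal.ofReal_le_ofReal ?_
  gcongr
  have h3 : (4 : ℝ) ^ j ≤ ‖ξ‖ ^ (2 * (1 : ℝ)) := by
    have e1 : ‖ξ‖ ^ (2 * (1 : ℝ)) = ‖ξ‖ ^ 2 := by norm_num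
    have e2 : (4 : ℝ) ^ j = ((2 : ℝ) ^ (j : ℝ)) ^ 2 := by
      rw [Real.rpow_intCast, show (4 : ℝ) = 2 * 2 by norm_num, mul_zpow]
      ring
    rw [e1, e2]
    gcongr
  have h4 : (4 : ℝ) ^ (j - k) / 4 = ((4 : ℝ) ^ (k + 1))⁻¹ * (4 : ℝ) ^ j := by
    rw [zpow_sub₀ (by norm_num), zpow_add_one₀ (by norm_num)]
    field_simp
  have h5 : ((4 : ℝ) ^ (k + 1))⁻¹ * (4 : ℝ) ^ j ≤ t * ‖ξ‖ ^ (2 * (1 : ℝ)) := by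
    gcongr
  linarith

lemma Real.exp_neg_le_rpow {x s : ℝ} (hx : 0 < x) (hs : 0 < s) :
    Real.exp (-x) ≤ (x / s) ^ (-s) := by
  have h : x / s ≤ Real.exp (x / s) := by linarith [Real.add_one_le_exp (x / s)]
  have h2 : (x / s) ^ s ≤ Real.exp x := by
    calc (x / s) ^ s ≤ Real.exp (x / s) ^ s := by gcongr
      _ = Real.exp x := by rw [← Real.exp_mul, div_mul_cancel₀ _ hs.ne']
  rw [Real.rpow_neg (by positivity), Real.exp_neg]
  gcongr

lemma summable_exp_neg_four_zpow_mul_rpow {s : ℝ} (hs : 0 < s) :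
    Summable fun m : ℤ => Real.exp (-((4 : ℝ) ^ m / 2)) * (2 : ℝ) ^ (s * (m : ℝ)) := by
  have hgeo : Summable fun m : ℕ => (2 : ℝ) ^ (-s * (m : ℝ)) := by
    have : Summable fun m : ℕ => ((2 : ℝ) ^ (-s)) ^ m :=
      summable_geometric_of_lt_one (by positivity)
        (Real.rpow_lt_one_of_one_lt_of_neg one_lt_two (by linarith))
    refine this.congr fun m => ?_
    rw [Real.rpow_mul (by norm_num), Real.rpow_natCast]
  refine Summable.of_nat_of_neg ?_ ?_
  · refine Summable.of_nonneg_of_le (fun m => by positivity) (fun m => ?_)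
      (hgeo.mul_left ((1 / (2 * s)) ^ (-s)))
    have h := Real.exp_neg_le_rpow (x := (4 : ℝ) ^ (m : ℤ) / 2) (by positivity) hs
    have e : ((4 : ℝ) ^ (m : ℤ) / 2 / s) ^ (-s)
        = (1 / (2 * s)) ^ (-s) * (2 : ℝ) ^ (-(2 * s) * (m : ℝ)) := by
      rw [show (4 : ℝ) ^ (m : ℤ) / 2 / s = (1 / (2 * s)) * (2 : ℝ) ^ (2 * (m : ℝ)) by
          rw [Real.rpow_mul (by norm_num), Real.rpow_natCast, zpow_natCast]
          norm_num
          field_simp,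
        Real.mul_rpow (by positivity) (by positivity), ← Real.rpow_mul (by norm_num)]
      congr 2
      ring
    rw [e] at h
    calc _ ≤ (1 / (2 * s)) ^ (-s) * (2 : ℝ) ^ (-(2 * s) * (m : ℝ))
          * (2 : ℝ) ^ (s * ((m : ℤ) : ℝ)) := by gcongr
      _ = _ := by
        rw [mul_assoc, ← Real.rpow_add (by norm_num)]
        congr 2
        push_cast
        ring
  · refine Summable.of_nonneg_of_le (fun m => by positivity) (fun m => ?_) hgeo
    have h : Real.exp (-((4 : ℝ) ^ (-(m : ℤ)) / 2)) ≤ 1 :=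
      Real.exp_le_one_iff.2 (neg_nonpos.2 (by positivity))
    refine (mul_le_of_le_one_left (by positivity) h).trans_eq ?_
    congr 1
    push_cast
    ring

lemma two_rpow_mul_intCast_add (s : ℝ) (k m : ℤ) :
    (2 : ℝ) ^ (s * ((k + m : ℤ) : ℝ)) = (2 : ℝ) ^ (s * (k : ℝ)) * (2 : ℝ) ^ (s * (m : ℝ)) := by
  rw [← Real.rpow_add (by norm_num)]
  congr 1
  push_cast
  ring

lemma Ealpha_le_of_blockEnergy_le {n : ℕ} (hn : 1 ≤ n) {g : EuclideanSpace ℝ (Fin n) → ℂ}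
    {s t C : ℝ} {v : ℤ → ℝ} (hs : 0 < s) (hv0 : ∀ m, 0 ≤ v m) (hvC : ∀ m, v m ≤ C) (k : ℤ)
    (hk : ((4 : ℝ) ^ (k + 1))⁻¹ ≤ t)
    (hb : ∀ m : ℤ, blockEnergy n g (k + m) ≤
      ENNReal.ofReal (v m * (2 : ℝ) ^ (s * ((k + m : ℤ) : ℝ)))) :
    Ealpha n g 1 t ≤ ENNReal.ofReal ((∑' m : ℤ,
      Real.exp (-((4 : ℝ) ^ m / 2)) * (2 : ℝ) ^ (s * (m : ℝ)) * v m) * (2 : ℝ) ^ (s * (k : ℝ))) := by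
  have hsum : Summable fun m : ℤ =>
      Real.exp (-((4 : ℝ) ^ m / 2)) * (2 : ℝ) ^ (s * (m : ℝ)) * v m :=
    Summable.of_nonneg_of_le (fun m => mul_nonneg (by positivity) (hv0 m))
      (fun m => mul_le_mul_of_nonneg_left (hvC m) (by positivity))
      ((summable_exp_neg_four_zpow_mul_rpow hs).mul_right C)
  rw [← tsum_mul_right, ENNReal.ofReal_tsum_of_nonneg
    (fun m => mul_nonneg (mul_nonneg (by positivity) (hv0 m)) (by positivity)) (hsum.mul_right _)]
  refine (Ealpha_le_tsum hn k hk).trans (ENNReal.tsum_le_tsum fun m => ?_)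
  refine (mul_le_mul_right (hb m) _).trans_eq ?_
  rw [← ENNReal.ofReal_mul (by positivity), two_rpow_mul_intCast_add]
  congr 1
  ring

lemma four_zpow_rpow (σ : ℝ) (k : ℤ) :
    ((4 : ℝ) ^ k) ^ (2 * σ) = (2 : ℝ) ^ (4 * σ * (k : ℝ)) := by
  rw [← Real.rpow_intCast, ← Real.rpow_mul (by norm_num), show (4 : ℝ) = (2 : ℝ) ^ (2 : ℝ) by
    norm_num, ← Real.rpow_mul (by norm_num)]
  congr 1
  norm_num
  ring

lemma exists_tsum_mul_lt {u : ℤ → ℝ} (hu0 : ∀ m, 0 ≤ u m) (hu : Summable u) {ε C : ℝ}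
    (hε : 0 < ε) (hC : 0 < C) :
    ∃ c : ℝ, 0 < c ∧ c ≤ C ∧ ∃ S : Finset ℤ,
      ∑' m : ℤ, u m * (if m ∈ S then c else C) < ε := by
  have hK : 0 ≤ ∑' m, u m := tsum_nonneg hu0
  obtain ⟨S, hS⟩ := ((tendsto_order.1 (tendsto_tsum_compl_atTop_zero u)).2
    (ε / (2 * C)) (by positivity)).exists
  refine ⟨min C (ε / (2 * (∑' m, u m + 1))), by positivity, min_le_left _ _, S, ?_⟩
  set c := min C (ε / (2 * (∑' m, u m + 1)))
  have hind : ∑' m : {x // x ∉ S}, u m = ∑' m, Set.indicator {x | x ∉ S} u m :=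
    tsum_subtype {x | x ∉ S} u
  have hsi : Summable (Set.indicator {x | x ∉ S} u) := hu.indicator _
  have hle : ∀ m, u m * (if m ∈ S then c else C)
      ≤ c * u m + C * Set.indicator {x | x ∉ S} u m := by
    intro m
    have hc : 0 ≤ c := by positivity
    by_cases hm : m ∈ S
    · simp [hm, mul_comm]
    · simp only [hm, if_false, Set.indicator, Set.mem_ofPred_eq, not_false_eq_true, if_true]
      nlinarith [mul_nonneg hc (hu0 m)]
  have hsr := (hu.mul_left c).add (hsi.mul_left C)
  have h0 : ∀ m, 0 ≤ u m * (if m ∈ S then c else C) := fun m => by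
    refine mul_nonneg (hu0 m) ?_
    split_ifs <;> positivity
  calc _ ≤ ∑' m, (c * u m + C * Set.indicator {x | x ∉ S} u m) :=
        (Summable.of_nonneg_of_le h0 hle hsr).tsum_le_tsum hle hsr
    _ = c * ∑' m, u m + C * ∑' m : {x // x ∉ S}, u m := by
        rw [(hu.mul_left c).tsum_add (hsi.mul_left C), tsum_mul_left, tsum_mul_left, hind]
    _ < ε := by
        have h1 : C * ∑' m : {x // x ∉ S}, u m < ε / 2 := by
          calc _ < C * (ε / (2 * C)) := by gcongr
            _ = ε / 2 := by field_simp
        have h2 : c * ∑' m, u m ≤ ε / 2 := by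
          calc _ ≤ (ε / (2 * (∑' m, u m + 1))) * (∑' m, u m + 1) := by
                gcongr
                · exact min_le_right _ _
                · linarith
            _ = ε / 2 := by field_simp
        linarith

theorem stmt6 (n : ℕ) (hn : 1 ≤ n) (σ : ℝ) (hσ : 0 < σ)
    (g : EuclideanSpace ℝ (Fin n) → ℂ) (hg_meas : Measurable g) :
    StrongACond n g (2 * σ) ↔
    (∃ c₁ c₂ : ℝ, 0 < c₁ ∧ 0 < c₂ ∧ ∀ t : ℝ, 0 < t →
      ENNReal.ofReal (c₁ * t ^ (-(2 * σ))) ≤ Ealpha n g 1 t ∧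
      Ealpha n g 1 t ≤ ENNReal.ofReal (c₂ * t ^ (-(2 * σ)))) := by
  rw [strongACond_iff_blockEnergy]
  have hs : 0 < 4 * σ := by positivity
  constructor
  · rintro ⟨c, C, hc, hC, M, hM, hu, hl⟩
    have hsum := summable_exp_neg_four_zpow_mul_rpow hs
    have hK : 0 < ∑' m : ℤ,
        Real.exp (-((4 : ℝ) ^ m / 2)) * (2 : ℝ) ^ (4 * σ * (m : ℝ)) * C :=
      (hsum.mul_right C).tsum_pos (fun m => by positivity) 0 (by positivity)
    refine ⟨Real.exp (-(8 * (4 : ℝ) ^ M)) * c * (2 : ℝ) ^ (-(4 * σ)), _, by positivity, hK,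
      fun t ht => ?_⟩
    obtain ⟨k, hk1, hk2⟩ := exists_mem_Ico_zpow (inv_pos.2 ht) (by norm_num : (1 : ℝ) < 4)
    have htp : t ^ (-(2 * σ)) = t⁻¹ ^ (2 * σ) := by
      rw [Real.rpow_neg ht.le, Real.inv_rpow ht.le]
    rw [htp]
    constructor
    · obtain ⟨j, hj1, hj2, hj⟩ := hl k
      refine le_trans ?_ (exp_mul_blockEnergy_le_Ealpha ht j)
      refine le_trans ?_ (mul_le_mul_right hj _)
      rw [← ENNReal.ofReal_mul (by positivity)]
      refine ENNReal.ofReal_le_ofReal ?_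
      have h1 : t * (4 : ℝ) ^ j ≤ (4 : ℝ) ^ M := by
        calc t * (4 : ℝ) ^ j ≤ ((4 : ℝ) ^ k)⁻¹ * (4 : ℝ) ^ (k + M) := by
              gcongr
              · exact (le_inv_comm₀ (by positivity) ht).1 hk1
              · norm_num
          _ = (4 : ℝ) ^ M := by
              rw [zpow_add₀ (by norm_num), zpow_natCast]
              field_simp
      have h2 : t⁻¹ ^ (2 * σ) ≤ (2 : ℝ) ^ (4 * σ) * (2 : ℝ) ^ (4 * σ * (j : ℝ)) := by
        calc t⁻¹ ^ (2 * σ) ≤ ((4 : ℝ) ^ (k + 1)) ^ (2 * σ) := by gcongr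
          _ ≤ ((4 : ℝ) ^ (j + 1)) ^ (2 * σ) := by
              gcongr
              norm_num
          _ = _ := by
              rw [four_zpow_rpow, add_comm j, two_rpow_mul_intCast_add]
              simp
      calc _ ≤ Real.exp (-(8 * (4 : ℝ) ^ M)) * c * (2 : ℝ) ^ (-(4 * σ)) *
            ((2 : ℝ) ^ (4 * σ) * (2 : ℝ) ^ (4 * σ * (j : ℝ))) := by gcongr
        _ = Real.exp (-(8 * (4 : ℝ) ^ M)) * (c * (2 : ℝ) ^ (4 * σ * (j : ℝ))) := by
            rw [Real.rpow_neg (by norm_num)]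
            field_simp
        _ ≤ _ := by gcongr
    · refine (Ealpha_le_of_blockEnergy_le hn hs (fun _ => hC.le) (fun _ => le_rfl) k
        (inv_le_of_inv_le₀ ht hk2.le) (fun m => hu (k + m))).trans ?_
      refine ENNReal.ofReal_le_ofReal ?_
      rw [← four_zpow_rpow]
      gcongr
  · rintro ⟨c₁, c₂, hc₁, hc₂, h⟩
    have htk : ∀ k : ℤ, ((4 : ℝ) ^ k)⁻¹ ^ (-(2 * σ)) = (2 : ℝ) ^ (4 * σ * (k : ℝ)) := fun k => by
      rw [Real.rpow_neg (by positivity), Real.inv_rpow (by positivity), inv_inv, four_zpow_rpow]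
    have hu : ∀ j : ℤ, blockEnergy n g j ≤
        ENNReal.ofReal (Real.exp 8 * c₂ * (2 : ℝ) ^ (4 * σ * (j : ℝ))) := fun j => by
      have hp : (0 : ℝ) < ((4 : ℝ) ^ j)⁻¹ := by positivity
      have h1 := (exp_mul_blockEnergy_le_Ealpha hp j).trans (h _ hp).2
      rw [htk, inv_mul_cancel₀ (by positivity), mul_one] at h1
      calc blockEnergy n g j
          = ENNReal.ofReal (Real.exp 8) * (ENNReal.ofReal (Real.exp (-8)) * blockEnergy n g j) := by
            rw [← mul_assoc, ← ENNReal.ofReal_mul (by positivity), ← Real.exp_add]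
            simp
        _ ≤ ENNReal.ofReal (Real.exp 8) * ENNReal.ofReal (c₂ * (2 : ℝ) ^ (4 * σ * (j : ℝ))) := by
            gcongr
        _ = _ := by rw [← ENNReal.ofReal_mul (by positivity), mul_assoc (Real.exp 8)]
    have hC : 0 < Real.exp 8 * c₂ := by positivity
    obtain ⟨c, hc, hcC, S, hS⟩ := exists_tsum_mul_lt (fun m => by positivity)
      (summable_exp_neg_four_zpow_mul_rpow hs) hc₁ hC
    obtain ⟨L, hL⟩ : ∃ L : ℕ, ∀ m ∈ S, |m| ≤ L := by
      refine ⟨∑ m ∈ S, m.natAbs, fun m hm => ?_⟩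
      rw [Int.abs_eq_natAbs]
      exact_mod_cast Finset.single_le_sum (f := Int.natAbs) (fun _ _ => Nat.zero_le _) hm
    refine ⟨c, _, hc, hC, 2 * L + 1, by positivity, hu, fun j₀ => ?_⟩
    by_contra! hcon
    have hp : (0 : ℝ) < ((4 : ℝ) ^ (j₀ + L))⁻¹ := by positivity
    have h1 := (h _ hp).1
    rw [htk] at h1
    have h2 := h1.trans (Ealpha_le_of_blockEnergy_le hn hs
      (v := fun m => if m ∈ S then c else Real.exp 8 * c₂)
      (fun m => by split_ifs <;> positivity)
      (fun m => by split_ifs; exacts [hcC, le_rfl]) (j₀ + L)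
      (inv_anti₀ (by positivity) (zpow_le_zpow_right₀ (by norm_num) (by omega))) (fun m => by
        split_ifs with hm
        · have := abs_le.1 (hL m hm)
          exact (hcon _ (by omega) (by push_cast; omega)).le
        · exact hu _))
    rw [ENNReal.ofReal_le_ofReal_iff (mul_nonneg (tsum_nonneg fun m => mul_nonneg (by positivity)
      (by split_ifs <;> positivity)) (by positivity))] at h2
    exact absurd (le_of_mul_le_mul_right h2 (by positivity)) (not_le.2 hS)
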